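/- arXiv:2503.17101 — 4 statements merged into one kernel-verified Lean document; each statement's English description precedes it below -/
import Mathlib

section
/- Let A ∈ ℝ^{m×n} be a real matrix of rank r with singular value decomposition A = Σ_{i=1}^r σ_i u_i v_iᵀ, where σ_1 ≥ σ_2 ≥ … ≥ σ_r > 0 and (u_i)_{i=1}^r ⊂ ℝ^m, (v_i)_{i=1}^r ⊂ ℝ^n are orthonormal families. For 1 ≤ k ≤ r let A_k = Σ_{i=1}^k σ_i u_i v_iᵀ be the truncated SVD. Then for every matrix B ∈ ℝ^{m×n} with rank(B) ≤ k, one has ‖A − A_k‖_F ≤ ‖A − B‖_F; i.e., A_k is an optimal rank-k approximation of A in the Frobenius norm. -/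
open Matrix Finset

/-- Frobenius norm of a real matrix. -/
noncomputable def frob {m n : ℕ} (M : Matrix (Fin m) (Fin n) ℝ) : ℝ :=
  Real.sqrt (∑ i, ∑ j, (M i j) ^ 2)

/-- Parseval's identity for a combination of an orthonormal family in `Fin n → ℝ`. -/
lemma sum_sq_sum_mul_of_orthonormal {ι : Type*} [Fintype ι] [DecidableEq ι] {n : ℕ}
    {v : ι → Fin n → ℝ}
    (hv : ∀ i j, (∑ x, v i x * v j x) = if i = j then (1 : ℝ) else 0) (y : ι → ℝ) :
    ∑ x, (∑ i, y i * v i x) ^ 2 = ∑ i, y i ^ 2 := by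
  calc ∑ x, (∑ i, y i * v i x) ^ 2
      = ∑ x, ∑ i, ∑ j, y i * y j * (v i x * v j x) := by
        refine sum_congr rfl fun x _ => ?_
        rw [sq, sum_mul_sum]
        exact sum_congr rfl fun i _ => sum_congr rfl fun j _ => by ring
    _ = ∑ i, ∑ j, y i * y j * ∑ x, v i x * v j x := by
        rw [sum_comm]
        refine sum_congr rfl fun i _ => ?_
        rw [sum_comm]
        exact sum_congr rfl fun j _ => (mul_sum _ _ _).symm
    _ = ∑ i, y i ^ 2 := by simp [hv, sq]

/-- The squared Frobenius norm of `∑ i, τ i • u i v iᵀ` for orthonormal `u` and `v`. -/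
lemma sum_sq_sum_smul_vecMulVec {ι : Type*} [Fintype ι] [DecidableEq ι] {m n : ℕ}
    {u : ι → Fin m → ℝ} {v : ι → Fin n → ℝ}
    (hu : ∀ i j, (∑ x, u i x * u j x) = if i = j then (1 : ℝ) else 0)
    (hv : ∀ i j, (∑ x, v i x * v j x) = if i = j then (1 : ℝ) else 0) (τ : ι → ℝ) :
    ∑ x, ∑ j, ((∑ i, τ i • vecMulVec (u i) (v i)) x j) ^ 2 = ∑ i, τ i ^ 2 := by
  have h (x : Fin m) : ∑ j, ((∑ i, τ i • vecMulVec (u i) (v i)) x j) ^ 2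
      = ∑ i, (τ i * u i x) ^ 2 := by
    rw [← sum_sq_sum_mul_of_orthonormal hv]
    simp [Matrix.sum_apply, vecMulVec_apply, mul_assoc]
  have hui (i : ι) : ∑ x, u i x ^ 2 = 1 := by simpa [sq] using hu i i
  simp_rw [h]
  rw [sum_comm]
  simp_rw [mul_pow, ← mul_sum, hui, mul_one]

/-- A weighted sum with weights in `[0, 1]` of total mass at most `k` is at most the sum of the
`k` largest terms. -/
lemma sum_mul_le_sum_filter_lt {r k : ℕ} (hk1 : 1 ≤ k) (hkr : k ≤ r) {s c : Fin r → ℝ}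
    (hs0 : ∀ i, 0 ≤ s i) (hs : Antitone s) (hc0 : ∀ i, 0 ≤ c i) (hc1 : ∀ i, c i ≤ 1)
    (hc : ∑ i, c i ≤ k) :
    ∑ i, s i * c i ≤ ∑ i : Fin r, if (i : ℕ) < k then s i else 0 := by
  let t : Fin r := ⟨k - 1, by omega⟩
  have hcard : ∑ i : Fin r, (if (i : ℕ) < k then (1 : ℝ) else 0) = k := by
    rw [sum_boole, Fin.card_filter_val_lt, min_eq_right hkr]
  have hterm (i : Fin r) : s t * ((if (i : ℕ) < k then (1 : ℝ) else 0) - c i)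
      ≤ (if (i : ℕ) < k then s i else 0) - s i * c i := by
    split_ifs with h
    · have := hs (show i ≤ t from Fin.le_def.2 (by simp only [t]; omega))
      nlinarith [hc1 i]
    · have := hs (show t ≤ i from Fin.le_def.2 (by simp only [t]; omega))
      nlinarith [hc0 i]
  have hsum := sum_le_sum fun i (_ : i ∈ univ) => hterm i
  rw [← mul_sum, sum_sub_distrib, sum_sub_distrib, hcard] at hsum
  nlinarith [hs0 t, mul_nonneg (hs0 t) (sub_nonneg.2 hc)]

/-- The squared distance from `a` to a point of a subspace is at least the squared norm of `a`
minus that of its projection, computed in an orthonormal basis of the subspace. -/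
lemma norm_sq_sub_sum_inner_sq_le {E ι : Type*} [NormedAddCommGroup E] [InnerProductSpace ℝ E]
    [Fintype ι] {W : Submodule ℝ E} (w : OrthonormalBasis ι ℝ W) (a : E) (b : W) :
    ‖a‖ ^ 2 - ∑ l, inner ℝ (w l : E) a ^ 2 ≤ ‖a - b‖ ^ 2 := by
  have hab : inner ℝ a (b : E) = ∑ l, w.repr b l * inner ℝ (w l : E) a := by
    conv_lhs => rw [← w.sum_repr b]
    simp [inner_sum, inner_smul_right, real_inner_comm]
  have hb : ‖(b : E)‖ ^ 2 = ∑ l, w.repr b l ^ 2 := by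
    rw [← Submodule.coe_norm, ← w.repr.norm_map b, EuclideanSpace.real_norm_sq_eq]
  have h : 0 ≤ ∑ l, (inner ℝ (w l : E) a - w.repr b l) ^ 2 :=
    sum_nonneg fun _ _ => sq_nonneg _
  have h' : ∑ l, (inner ℝ (w l : E) a - w.repr b l) ^ 2 = ∑ l, inner ℝ (w l : E) a ^ 2
      - 2 * (∑ l, w.repr b l * inner ℝ (w l : E) a) + ∑ l, w.repr b l ^ 2 := by
    rw [mul_sum, ← sum_sub_distrib, ← sum_add_distrib]
    exact sum_congr rfl fun _ _ => by ring
  rw [norm_sub_sq_real, hab, hb]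
  linarith

/-- Eckart–Young–Mirsky: the truncated SVD is an optimal rank-`k` approximation in
the Frobenius norm. -/
theorem eckart_young_mirsky_frobenius
    (m n r k : ℕ) (A : Matrix (Fin m) (Fin n) ℝ)
    (σ : Fin r → ℝ) (u : Fin r → Fin m → ℝ) (v : Fin r → Fin n → ℝ)
    (hrank : A.rank = r)
    (hσpos : ∀ i, 0 < σ i)
    (hσanti : ∀ i j : Fin r, i ≤ j → σ j ≤ σ i)
    (hu : ∀ i j : Fin r, (∑ x, u i x * u j x) = if i = j then (1 : ℝ) else 0)
    (hv : ∀ i j : Fin r, (∑ x, v i x * v j x) = if i = j then (1 : ℝ) else 0)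
    (hA : A = ∑ i : Fin r, σ i • vecMulVec (u i) (v i))
    (hk1 : 1 ≤ k) (hkr : k ≤ r)
    (Ak : Matrix (Fin m) (Fin n) ℝ)
    (hAk : Ak = ∑ i ∈ Finset.univ.filter (fun i : Fin r => (i : ℕ) < k),
        σ i • vecMulVec (u i) (v i))
    (B : Matrix (Fin m) (Fin n) ℝ) (hB : B.rank ≤ k) :
    frob (A - Ak) ≤ frob (A - B) := by
  apply Real.sqrt_le_sqrt
  have hdiff : A - Ak = ∑ i : Fin r, (if (i : ℕ) < k then 0 else σ i) • vecMulVec (u i) (v i) := by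
    rw [hA, hAk, sum_filter, ← sum_sub_distrib]
    refine sum_congr rfl fun i _ => ?_
    split_ifs <;> simp
  rw [hdiff, sum_sq_sum_smul_vecMulVec hu hv]
  let e := (WithLp.linearEquiv 2 ℝ (Fin m → ℝ)).symm
  let W : Submodule ℝ (EuclideanSpace ℝ (Fin m)) :=
    (Submodule.span ℝ (Set.range B.col)).map e.toLinearMap
  have hW : Module.finrank ℝ W ≤ k := by
    rwa [LinearEquiv.finrank_map_eq, ← Matrix.rank_eq_finrank_span_cols]
  let w := stdOrthonormalBasis ℝ W
  let U : Fin r → EuclideanSpace ℝ (Fin m) := fun i => WithLp.toLp 2 (u i)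
  have hU : Orthonormal ℝ U := by
    rw [orthonormal_iff_ite]
    intro i j
    simpa [U, PiLp.inner_apply, mul_comm] using hu i j
  have hw : Orthonormal ℝ fun l => (w l : EuclideanSpace ℝ (Fin m)) :=
    w.orthonormal.comp_linearIsometry W.subtypeₗᵢ
  let c : Fin r → ℝ := fun i => ∑ l, inner ℝ (w l : EuclideanSpace ℝ (Fin m)) (U i) ^ 2
  have hc1 (i : Fin r) : c i ≤ 1 := by
    simpa [c, hU.1 i] using hw.sum_inner_products_le (U i) (s := univ)
  have hc : ∑ i, c i ≤ k := by
    calc ∑ i, c i = ∑ l, ∑ i, inner ℝ (w l : EuclideanSpace ℝ (Fin m)) (U i) ^ 2 := sum_comm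
      _ ≤ ∑ l, (1 : ℝ) := sum_le_sum fun l _ => by
        simpa [hw.1 l, real_inner_comm] using
          hU.sum_inner_products_le (w l : EuclideanSpace ℝ (Fin m)) (s := univ)
      _ ≤ k := by simpa using hW
  let a : Fin n → EuclideanSpace ℝ (Fin m) := fun j => WithLp.toLp 2 (A.col j)
  have ha (j : Fin n) : a j = ∑ i, (σ i * v i j) • U i := by
    ext x
    simp only [a, U, hA, Matrix.col_apply, Matrix.sum_apply, Matrix.smul_apply, vecMulVec_apply,
      WithLp.ofLp_sum, Finset.sum_apply, WithLp.ofLp_smul, Pi.smul_apply, smul_eq_mul]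
    exact sum_congr rfl fun i _ => by ring
  have hproj : ∑ j, ∑ l, inner ℝ (w l : EuclideanSpace ℝ (Fin m)) (a j) ^ 2 =
      ∑ i, σ i ^ 2 * c i := by
    rw [sum_comm]
    have h (l) : ∑ j, inner ℝ (w l : EuclideanSpace ℝ (Fin m)) (a j) ^ 2
        = ∑ i, (σ i * inner ℝ (w l : EuclideanSpace ℝ (Fin m)) (U i)) ^ 2 := by
      rw [← sum_sq_sum_mul_of_orthonormal hv]
      refine sum_congr rfl fun j _ => ?_
      rw [ha, inner_sum]
      simp_rw [inner_smul_right]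
      congr 1
      exact sum_congr rfl fun i _ => by ring
    simp_rw [h, c, mul_sum, mul_pow]
    exact sum_comm
  have hnorm : ∑ j, ‖a j‖ ^ 2 = ∑ i, σ i ^ 2 := by
    rw [← sum_sq_sum_smul_vecMulVec hu hv, ← hA, sum_comm]
    exact sum_congr rfl fun j _ => EuclideanSpace.real_norm_sq_eq _
  have hdist : ∑ x, ∑ j, ((A - B) x j) ^ 2 = ∑ j, ‖a j - WithLp.toLp 2 (B.col j)‖ ^ 2 := by
    rw [sum_comm]
    refine sum_congr rfl fun j _ => ?_
    rw [EuclideanSpace.real_norm_sq_eq]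
    rfl
  have hlow : ∑ j, (‖a j‖ ^ 2 - ∑ l, inner ℝ (w l : EuclideanSpace ℝ (Fin m)) (a j) ^ 2)
      ≤ ∑ j, ‖a j - WithLp.toLp 2 (B.col j)‖ ^ 2 := sum_le_sum fun j _ =>
    norm_sq_sub_sum_inner_sq_le w (a j)
      ⟨WithLp.toLp 2 (B.col j), B.col j, Submodule.subset_span ⟨j, rfl⟩, rfl⟩
  rw [sum_sub_distrib, hnorm, hproj] at hlow
  have hweights := sum_mul_le_sum_filter_lt hk1 hkr (s := fun i => σ i ^ 2)
    (fun i => sq_nonneg _) (fun i j hij => pow_le_pow_left₀ (hσpos j).le (hσanti i j hij) 2)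
    (fun i => sum_nonneg fun _ _ => sq_nonneg _) hc1 hc
  have htail : ∑ i : Fin r, (if (i : ℕ) < k then 0 else σ i) ^ 2
      = ∑ i, σ i ^ 2 - ∑ i : Fin r, if (i : ℕ) < k then σ i ^ 2 else 0 := by
    rw [← sum_sub_distrib]
    refine sum_congr rfl fun i _ => ?_
    split_ifs <;> simp
  rw [hdist, htail]
  linarith
end

section
/- Let A ∈ ℝ^{m×n} be a real matrix of rank r with singular value decomposition A = Σ_{i=1}^r σ_i u_i v_iᵀ, where σ_1 ≥ σ_2 ≥ … ≥ σ_r > 0 and (u_i)_{i=1}^r ⊂ ℝ^m, (v_i)_{i=1}^r ⊂ ℝ^n are orthonormal families. For 1 ≤ k < r let A_k = Σ_{i=1}^k σ_i u_i v_iᵀ. Then ‖A − A_k‖_2 = σ_{k+1}, and for every matrix B ∈ ℝ^{m×n} with rank(B) ≤ k one has ‖A − A_k‖_2 ≤ ‖A − B‖_2, where ‖·‖_2 denotes the spectral norm (operator norm induced by the Euclidean vector norm). -/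
open Matrix Finset

/-- Spectral norm (operator norm induced by the Euclidean vector norm) of a real matrix. -/
noncomputable def specNorm {m n : ℕ} (M : Matrix (Fin m) (Fin n) ℝ) : ℝ :=
  ‖LinearMap.toContinuousLinearMap (Matrix.toEuclideanLin M)‖

lemma norm_toLp_sq_eq_dotProduct {ι : Type*} [Fintype ι] (x : ι → ℝ) :
    ‖WithLp.toLp 2 x‖ ^ 2 = x ⬝ᵥ x := by
  rw [EuclideanSpace.norm_sq_eq]
  simp [dotProduct, pow_two]

lemma specNorm_nonneg {m n : ℕ} (M : Matrix (Fin m) (Fin n) ℝ) : 0 ≤ specNorm M :=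
  norm_nonneg _

lemma specNorm_le_of_dotProduct_le {m n : ℕ} (M : Matrix (Fin m) (Fin n) ℝ) {c : ℝ} (hc : 0 ≤ c)
    (h : ∀ x, (M *ᵥ x) ⬝ᵥ (M *ᵥ x) ≤ c ^ 2 * (x ⬝ᵥ x)) : specNorm M ≤ c := by
  refine ContinuousLinearMap.opNorm_le_bound _ hc fun x => ?_
  refine le_of_sq_le_sq ?_ (by positivity)
  rw [mul_pow, LinearMap.coe_toContinuousLinearMap', toLpLin_apply,
    norm_toLp_sq_eq_dotProduct]
  simpa [← norm_toLp_sq_eq_dotProduct x.ofLp] using h x.ofLp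

lemma le_specNorm_of_le_dotProduct {m n : ℕ} (M : Matrix (Fin m) (Fin n) ℝ) {c : ℝ}
    {x : Fin n → ℝ} (hx : x ⬝ᵥ x ≠ 0)
    (h : c ^ 2 * (x ⬝ᵥ x) ≤ (M *ᵥ x) ⬝ᵥ (M *ᵥ x)) : c ≤ specNorm M := by
  have hle := (LinearMap.toContinuousLinearMap (Matrix.toEuclideanLin M)).le_opNorm
    (WithLp.toLp 2 x)
  have hsq := pow_le_pow_left₀ (norm_nonneg _) hle 2
  rw [mul_pow, LinearMap.coe_toContinuousLinearMap', toLpLin_apply,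
    norm_toLp_sq_eq_dotProduct, norm_toLp_sq_eq_dotProduct] at hsq
  have hpos : 0 < x ⬝ᵥ x :=
    lt_of_le_of_ne (by rw [← norm_toLp_sq_eq_dotProduct]; positivity) hx.symm
  exact le_of_sq_le_sq (le_of_mul_le_mul_right (h.trans hsq) hpos) (specNorm_nonneg M)

section Orthonormal

variable {ι κ : Type*} [Fintype κ] [DecidableEq ι] {u : ι → κ → ℝ}

lemma dotProduct_sum_smul_of_orthonormal
    (hu : ∀ i j, u i ⬝ᵥ u j = if i = j then (1 : ℝ) else 0) (s : Finset ι) (c : ι → ℝ) :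
    (∑ i ∈ s, c i • u i) ⬝ᵥ (∑ i ∈ s, c i • u i) = ∑ i ∈ s, c i ^ 2 := by
  simp only [sum_dotProduct, dotProduct_sum, smul_dotProduct, dotProduct_smul, hu, smul_eq_mul]
  refine Finset.sum_congr rfl fun i hi => ?_
  simp [hi, pow_two]

lemma sum_dotProduct_sq_le_of_orthonormal
    (hu : ∀ i j, u i ⬝ᵥ u j = if i = j then (1 : ℝ) else 0) (s : Finset ι) (x : κ → ℝ) :
    ∑ i ∈ s, (u i ⬝ᵥ x) ^ 2 ≤ x ⬝ᵥ x := by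
  set y := ∑ i ∈ s, (u i ⬝ᵥ x) • u i with hy
  have hyy : y ⬝ᵥ y = ∑ i ∈ s, (u i ⬝ᵥ x) ^ 2 := dotProduct_sum_smul_of_orthonormal hu s _
  have hyx : y ⬝ᵥ x = ∑ i ∈ s, (u i ⬝ᵥ x) ^ 2 := by
    simp [hy, sum_dotProduct, smul_dotProduct, pow_two]
  have h : 0 ≤ (x - y) ⬝ᵥ (x - y) := by rw [← norm_toLp_sq_eq_dotProduct]; positivity
  simp only [sub_dotProduct, dotProduct_sub, dotProduct_comm x y, hyy, hyx] at h
  linarith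

end Orthonormal

lemma sum_smul_vecMulVec_mulVec {ι κ l : Type*} [Fintype κ] (s : Finset ι)
    (σ : ι → ℝ) (u : ι → l → ℝ) (v : ι → κ → ℝ) (x : κ → ℝ) :
    (∑ i ∈ s, σ i • vecMulVec (u i) (v i)) *ᵥ x = ∑ i ∈ s, (σ i * (v i ⬝ᵥ x)) • u i := by
  rw [Matrix.sum_mulVec]
  refine Finset.sum_congr rfl fun i _ => ?_
  rw [smul_mulVec, vecMulVec_mulVec, mul_smul, op_smul_eq_smul]

lemma exists_ne_zero_mulVec_sum_smul_eq_zero {l κ ι : Type*} [Fintype l] [Fintype κ] [Fintype ι]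
    (B : Matrix l κ ℝ) (hB : B.rank < Fintype.card ι) (w : ι → κ → ℝ) :
    ∃ c : ι → ℝ, c ≠ 0 ∧ B *ᵥ (∑ i, c i • w i) = 0 := by
  let V : Matrix κ ι ℝ := (Matrix.of w)ᵀ
  have hV : ∀ c, V *ᵥ c = ∑ i, c i • w i := fun c => by
    ext x; simp [V, mulVec, dotProduct, mul_comm]
  have hlt : (B * V).rank < Fintype.card ι := (rank_mul_le_left B V).trans_lt hB
  have hker : LinearMap.ker (B * V).mulVecLin ≠ ⊥ := by
    intro h
    have := (B * V).mulVecLin.finrank_range_add_finrank_ker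
    rw [h, finrank_bot, Module.finrank_fintype_fun_eq_card] at this
    exact hlt.ne this
  obtain ⟨c, hc, hne⟩ := Submodule.exists_mem_ne_zero_of_ne_bot hker
  refine ⟨c, hne, ?_⟩
  rw [← hV, mulVec_mulVec]
  simpa using hc

/-- Eckart–Young–Mirsky for the spectral norm: the truncated SVD has error `σ_{k+1}` and is an
optimal rank-`k` approximation in the spectral norm. -/
theorem eckart_young_mirsky_spectral
    (m n r k : ℕ) (A : Matrix (Fin m) (Fin n) ℝ)
    (σ : Fin r → ℝ) (u : Fin r → Fin m → ℝ) (v : Fin r → Fin n → ℝ)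
    (hrank : A.rank = r)
    (hσpos : ∀ i, 0 < σ i)
    (hσanti : ∀ i j : Fin r, i ≤ j → σ j ≤ σ i)
    (hu : ∀ i j : Fin r, (∑ x, u i x * u j x) = if i = j then (1 : ℝ) else 0)
    (hv : ∀ i j : Fin r, (∑ x, v i x * v j x) = if i = j then (1 : ℝ) else 0)
    (hA : A = ∑ i : Fin r, σ i • vecMulVec (u i) (v i))
    (hk1 : 1 ≤ k) (hkr : k < r)
    (Ak : Matrix (Fin m) (Fin n) ℝ)
    (hAk : Ak = ∑ i ∈ Finset.univ.filter (fun i : Fin r => (i : ℕ) < k),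
        σ i • vecMulVec (u i) (v i)) :
    specNorm (A - Ak) = σ ⟨k, hkr⟩ ∧
      ∀ B : Matrix (Fin m) (Fin n) ℝ, B.rank ≤ k →
        specNorm (A - Ak) ≤ specNorm (A - B) := by
  have hu' : ∀ i j, u i ⬝ᵥ u j = if i = j then (1 : ℝ) else 0 := hu
  have hv' : ∀ i j, v i ⬝ᵥ v j = if i = j then (1 : ℝ) else 0 := hv
  set K : Fin r := ⟨k, hkr⟩ with hK
  have hsub : A - Ak = ∑ i ∈ univ.filter (fun i : Fin r => ¬ (i : ℕ) < k),
      σ i • vecMulVec (u i) (v i) := by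
    rw [hA, hAk, sub_eq_iff_eq_add', sum_filter_add_sum_filter_not]
  have hupper : specNorm (A - Ak) ≤ σ K := by
    refine specNorm_le_of_dotProduct_le _ (hσpos K).le fun x => ?_
    rw [hsub, sum_smul_vecMulVec_mulVec, dotProduct_sum_smul_of_orthonormal hu']
    refine le_trans ?_ (mul_le_mul_of_nonneg_left
      (sum_dotProduct_sq_le_of_orthonormal hv'
        (univ.filter fun i : Fin r => ¬ (i : ℕ) < k) x) (sq_nonneg _))
    rw [mul_sum]
    refine sum_le_sum fun i hi => ?_
    rw [mul_pow]
    have hKi : K ≤ i := by simpa [hK, Fin.le_def] using hi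
    gcongr
    · exact (hσpos i).le
    · exact hσanti K i hKi
  have hlower : σ K ≤ specNorm (A - Ak) := by
    refine le_specNorm_of_le_dotProduct _ (x := v K) (by simp [hv']) ?_
    rw [hsub, sum_smul_vecMulVec_mulVec, dotProduct_sum_smul_of_orthonormal hu']
    simp [hv', hK]
  refine ⟨le_antisymm hupper hlower, fun B hB => hupper.trans ?_⟩
  let e : Fin (k + 1) → Fin r := Fin.castLE hkr
  have he : Function.Injective e := Fin.castLE_injective hkr
  have hue : ∀ i j, (u ∘ e) i ⬝ᵥ (u ∘ e) j = if i = j then (1 : ℝ) else 0 := by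
    simp [hu', he.eq_iff]
  have hve : ∀ i j, (v ∘ e) i ⬝ᵥ (v ∘ e) j = if i = j then (1 : ℝ) else 0 := by
    simp [hv', he.eq_iff]
  obtain ⟨c, hc, hBc⟩ := exists_ne_zero_mulVec_sum_smul_eq_zero B
    (by simpa using Nat.lt_succ_of_le hB) (v ∘ e)
  have hAv : ∀ i, A *ᵥ v i = σ i • u i := fun i => by
    simp [hA, sum_smul_vecMulVec_mulVec, hv']
  have hAx : A *ᵥ (∑ j, c j • (v ∘ e) j) = ∑ j, (c j * σ (e j)) • (u ∘ e) j := by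
    simp [mulVec_sum, mulVec_smul, hAv, mul_smul]
  refine le_specNorm_of_le_dotProduct _ (x := ∑ j, c j • (v ∘ e) j) ?_ ?_
  · rw [dotProduct_sum_smul_of_orthonormal hve]
    intro h
    rw [sum_eq_zero_iff_of_nonneg fun _ _ => sq_nonneg _] at h
    exact hc (funext fun j => by simpa using h j (mem_univ j))
  · rw [sub_mulVec, hBc, sub_zero, hAx, dotProduct_sum_smul_of_orthonormal hue,
      dotProduct_sum_smul_of_orthonormal hve, mul_sum]
    refine sum_le_sum fun j _ => ?_
    rw [mul_pow, mul_comm]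
    have hjK : e j ≤ K := by
      rw [Fin.le_def]; exact Nat.le_of_lt_succ j.isLt
    gcongr
    · exact (hσpos K).le
    · exact hσanti (e j) K hjK
end

section
/- Let X ∈ ℝ^{n×p} have full row rank n and let S ∈ ℝ^{n×n} be invertible with S Sᵀ = X Xᵀ. Let (u_i)_{i∈T} be an orthonormal family in ℝ^m, (v_i)_{i∈T} an orthonormal family in ℝ^n indexed by a finite set T, and (c_i)_{i∈T} real coefficients. Then ‖(Σ_{i∈T} c_i u_i v_iᵀ) S^{-1} X‖_F² = Σ_{i∈T} c_i². -/
open Matrix Finset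

/-- The squared Frobenius norm is the trace of the Gram matrix. -/
theorem frob_sq_eq_trace {m n : ℕ} (M : Matrix (Fin m) (Fin n) ℝ) :
    frob M ^ 2 = (M * Mᵀ).trace := by
  rw [frob, Real.sq_sqrt (by positivity)]
  simp [Matrix.trace, Matrix.mul_apply, pow_two]

/-- Right multiplication by `S⁻¹ X` preserves Gram matrices when `S Sᵀ = X Xᵀ`. -/
theorem mul_inv_mul_mul_transpose_self {m n p : ℕ} (A : Matrix (Fin m) (Fin n) ℝ)
    (X : Matrix (Fin n) (Fin p) ℝ) (S : Matrix (Fin n) (Fin n) ℝ) (hS : IsUnit S.det)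
    (hSS : S * Sᵀ = X * Xᵀ) :
    (A * S⁻¹ * X) * (A * S⁻¹ * X)ᵀ = A * Aᵀ := by
  have hST : IsUnit Sᵀ.det := by rwa [det_transpose]
  calc (A * S⁻¹ * X) * (A * S⁻¹ * X)ᵀ
      = A * (S⁻¹ * (X * Xᵀ) * (Sᵀ)⁻¹) * Aᵀ := by
        simp only [transpose_mul, transpose_nonsing_inv, Matrix.mul_assoc]
    _ = A * Aᵀ := by
        rw [← hSS, nonsing_inv_mul_cancel_left _ _ hS, mul_nonsing_inv _ hST, Matrix.mul_one]

/-- The squared Frobenius norm of a combination of orthonormal rank-one matrices. -/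
theorem trace_sum_smul_vecMulVec_mul_transpose {m n : ℕ} {T : Type} [Fintype T] [DecidableEq T]
    (u : T → Fin m → ℝ) (v : T → Fin n → ℝ) (c : T → ℝ)
    (hu : ∀ i j : T, (∑ x, u i x * u j x) = if i = j then (1 : ℝ) else 0)
    (hv : ∀ i j : T, (∑ x, v i x * v j x) = if i = j then (1 : ℝ) else 0) :
    ((∑ i : T, c i • vecMulVec (u i) (v i)) * (∑ i : T, c i • vecMulVec (u i) (v i))ᵀ).trace
      = ∑ i : T, c i ^ 2 := by
  have hdot (i j : T) : u i ⬝ᵥ u j = if i = j then (1 : ℝ) else 0 := hu i j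
  have hdot' (i j : T) : v i ⬝ᵥ v j = if i = j then (1 : ℝ) else 0 := hv i j
  simp [transpose_sum, Matrix.sum_mul, Matrix.mul_sum, trace_sum, transpose_vecMulVec,
    vecMulVec_mul_vecMulVec, trace_vecMulVec, hdot, hdot', pow_two, apply_ite (dotProduct _)]

/-- For orthonormal families `(u_i)`, `(v_i)` and a whitening matrix `S` with `S Sᵀ = X Xᵀ`,
the squared Frobenius norm of `(Σ_i c_i u_i v_iᵀ) S⁻¹ X` equals `Σ_i c_i²`. -/
theorem whitened_orthonormal_sum_sq_frobenius
    (m n p : ℕ) (T : Type) [Fintype T] [DecidableEq T]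
    (X : Matrix (Fin n) (Fin p) ℝ) (hX : X.rank = n)
    (S : Matrix (Fin n) (Fin n) ℝ) (hS : IsUnit S.det)
    (hSS : S * Sᵀ = X * Xᵀ)
    (u : T → Fin m → ℝ) (v : T → Fin n → ℝ) (c : T → ℝ)
    (hu : ∀ i j : T, (∑ x, u i x * u j x) = if i = j then (1 : ℝ) else 0)
    (hv : ∀ i j : T, (∑ x, v i x * v j x) = if i = j then (1 : ℝ) else 0) :
    frob ((∑ i : T, c i • vecMulVec (u i) (v i)) * S⁻¹ * X) ^ 2 = ∑ i : T, c i ^ 2 := by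
  rw [frob_sq_eq_trace, mul_inv_mul_mul_transpose_self _ X S hS hSS,
    trace_sum_smul_vecMulVec_mul_transpose u v c hu hv]
end

section
/- Let A ∈ ℝ^{m×n} and let X ∈ ℝ^{n×p} have full row rank n. Let S ∈ ℝ^{n×n} be the Cholesky factor of X Xᵀ, i.e., a lower triangular matrix with positive diagonal entries satisfying S Sᵀ = X Xᵀ (so S is invertible). Let A S = Σ_{i=1}^r σ_i u_i v_iᵀ be an SVD of A S, where r = rank(A S), σ_1 ≥ … ≥ σ_r > 0, and (u_i), (v_i) are orthonormal families. Fix an index j with 1 ≤ j ≤ r and define Ã = (Σ_{i≠j, 1≤i≤r} σ_i u_i v_iᵀ) S^{-1}, i.e., the matrix obtained by truncating the j-th singular term of A S and undoing the scaling. Then the compression loss equals the truncated singular value: ‖(A − Ã) X‖_F = σ_j. -/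
open Matrix Finset

theorem frob_eq_sqrt_trace {m n : ℕ} (M : Matrix (Fin m) (Fin n) ℝ) :
    frob M = Real.sqrt (M * Mᵀ).trace := by
  simp [frob, Matrix.trace, Matrix.mul_apply, sq]

/-- The Frobenius norm of `B * X` depends on `X` only through the Gram matrix `X * Xᵀ`. -/
theorem frob_mul_eq_of_gram_eq {m n p q : ℕ} (B : Matrix (Fin m) (Fin n) ℝ)
    {X : Matrix (Fin n) (Fin p) ℝ} {S : Matrix (Fin n) (Fin q) ℝ} (h : S * Sᵀ = X * Xᵀ) :
    frob (B * X) = frob (B * S) := by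
  have gram {k : ℕ} (Y : Matrix (Fin n) (Fin k) ℝ) : B * Y * (B * Y)ᵀ = B * (Y * Yᵀ) * Bᵀ := by
    simp only [Matrix.transpose_mul, Matrix.mul_assoc]
  rw [frob_eq_sqrt_trace, frob_eq_sqrt_trace, gram, gram, h]

theorem frob_smul_vecMulVec {m n : ℕ} {c : ℝ} (hc : 0 ≤ c) {a : Fin m → ℝ} {b : Fin n → ℝ}
    (ha : ∑ x, a x * a x = 1) (hb : ∑ x, b x * b x = 1) :
    frob (c • vecMulVec a b) = c := by
  have h : ∑ i, ∑ k, ((c • vecMulVec a b) i k) ^ 2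
      = c ^ 2 * ((∑ x, a x * a x) * ∑ x, b x * b x) := by
    rw [Finset.sum_mul_sum, Finset.mul_sum]
    refine Finset.sum_congr rfl fun i _ => ?_
    rw [Finset.mul_sum]
    refine Finset.sum_congr rfl fun k _ => ?_
    simp only [Matrix.smul_apply, Matrix.vecMulVec_apply, smul_eq_mul]
    ring
  rw [frob, h, ha, hb, mul_one, mul_one, Real.sqrt_sq hc]

theorem isUnit_det_of_lowerTriangular {n : ℕ} {S : Matrix (Fin n) (Fin n) ℝ}
    (hlow : ∀ i j : Fin n, i < j → S i j = 0) (hdiag : ∀ i, 0 < S i i) : IsUnit S.det := by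
  rw [Matrix.det_of_isLowerTriangular S fun i j hij => hlow i j hij]
  exact (Finset.prod_pos fun i _ => hdiag i).ne'.isUnit

/-- ASVD-I, single truncation: with `S` the Cholesky factor of `X Xᵀ` and an SVD of `A S`,
truncating the `j`-th singular term yields compression loss exactly `σ_j`. -/
theorem asvd_cholesky_single_truncation_loss
    (m n p r : ℕ) (A : Matrix (Fin m) (Fin n) ℝ)
    (X : Matrix (Fin n) (Fin p) ℝ) (hX : X.rank = n)
    (S : Matrix (Fin n) (Fin n) ℝ)
    (hSlow : ∀ i j : Fin n, i < j → S i j = 0)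
    (hSdiag : ∀ i, 0 < S i i)
    (hSS : S * Sᵀ = X * Xᵀ)
    (σ : Fin r → ℝ) (u : Fin r → Fin m → ℝ) (v : Fin r → Fin n → ℝ)
    (hr : (A * S).rank = r)
    (hσpos : ∀ i, 0 < σ i)
    (hσanti : ∀ i j : Fin r, i ≤ j → σ j ≤ σ i)
    (hu : ∀ i j : Fin r, (∑ x, u i x * u j x) = if i = j then (1 : ℝ) else 0)
    (hv : ∀ i j : Fin r, (∑ x, v i x * v j x) = if i = j then (1 : ℝ) else 0)
    (hAS : A * S = ∑ i : Fin r, σ i • vecMulVec (u i) (v i))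
    (j : Fin r)
    (Atil : Matrix (Fin m) (Fin n) ℝ)
    (hAtil : Atil = (∑ i ∈ Finset.univ.filter (fun i : Fin r => i ≠ j),
        σ i • vecMulVec (u i) (v i)) * S⁻¹) :
    frob ((A - Atil) * X) = σ j := by
  have hdet : IsUnit S.det := isUnit_det_of_lowerTriangular hSlow hSdiag
  have hterm : (A - Atil) * S = σ j • vecMulVec (u j) (v j) := by
    rw [Matrix.sub_mul, hAtil, Matrix.nonsing_inv_mul_cancel_right _ _ hdet, hAS,
      Finset.filter_ne', ← Finset.add_sum_erase _ _ (Finset.mem_univ j), add_sub_cancel_right]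
  rw [frob_mul_eq_of_gram_eq _ hSS, hterm]
  exact frob_smul_vecMulVec (hσpos j).le (by simpa using hu j j) (by simpa using hv j j)
end
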